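/- (Proposition 1(i).) Let S = {x ∈ ℝⁿ : Fx ≤ 𝟏} be compact with 0 in its interior and gauge Ψ(x) = max_{1≤j≤p} F_{j,:}x, let A(w) = Σ_i w_i A_i, B(w) = Σ_i w_i B_i for w in the simplex W, and let Φ satisfy the contraction condition Ψ(A(w)x + B(w)Φ(x)) ≤ λΨ(x) on S with λ ∈ (0,1). Let Φ_NN satisfy ‖Φ(x) − Φ_NN(x)‖_∞ ≤ ē on S, set τ = ‖F‖_∞ · max_i ‖B_i‖_∞, fix ρ ∈ (λ,1) and b ∈ (0,1] with τē/(ρ−λ) ≤ b (and τē/(1−λ) < b). Then any trajectory x(k+1) = A(w_k)x(k) + B(w_k)Φ_NN(x(k)) with x(0) ∈ S and w_k ∈ W for all k satisfies, for all k ∈ ℕ, x(k) ∈ S and Ψ(x(k)) ≤ max(b, ρ^k Ψ(x(0))); in particular the trajectory remains in S and converges exponentially with rate ρ to the set bS = {x : Ψ(x) ≤ b}. -/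

import Mathlib

/-- The polyhedral set `S = {x ∈ ℝⁿ | F x ≤ 𝟏}` (componentwise). -/
def polySet {p n : ℕ} (F : Matrix (Fin p) (Fin n) ℝ) : Set (Fin n → ℝ) :=
  {x | ∀ j, F.mulVec x j ≤ 1}

/-- The polyhedral gauge function `Ψ(x) = max_{1 ≤ j ≤ p} F_{j,:} x`. -/
noncomputable def gaugeFn {p n : ℕ} (F : Matrix (Fin p) (Fin n) ℝ) (x : Fin n → ℝ) : ℝ :=
  ⨆ j, F.mulVec x j

/-- The uncertainty simplex `W = {w ∈ ℝ^M | Σᵢ wᵢ = 1, w ≥ 0}`. -/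
def simplexW (M : ℕ) : Set (Fin M → ℝ) := {w | ∑ i, w i = 1 ∧ ∀ i, 0 ≤ w i}

/-- The operator norm of a matrix induced by the `∞`-norms (the sup norms on the
function spaces `Fin b → ℝ` and `Fin a → ℝ`). -/
noncomputable def opNormInf {a b : ℕ} (A : Matrix (Fin a) (Fin b) ℝ) : ℝ :=
  ‖LinearMap.toContinuousLinearMap (Matrix.toLin' A)‖

theorem opNormInf_mulVec_le {a b : ℕ} (A : Matrix (Fin a) (Fin b) ℝ) (v : Fin b → ℝ) :
    ‖A.mulVec v‖ ≤ opNormInf A * ‖v‖ := by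
  have h := (LinearMap.toContinuousLinearMap (Matrix.toLin' A)).le_opNorm v
  simpa [opNormInf] using h

theorem opNormInf_nonneg {a b : ℕ} (A : Matrix (Fin a) (Fin b) ℝ) : 0 ≤ opNormInf A :=
  norm_nonneg _

theorem simplex_mulVec_le {n m M : ℕ} (B : Fin M → Matrix (Fin n) (Fin m) ℝ)
    (w : Fin M → ℝ) (hw : w ∈ simplexW M) (v : Fin m → ℝ) :
    ‖(∑ i, w i • B i).mulVec v‖ ≤ (⨆ i, opNormInf (B i)) * ‖v‖ := by
  obtain ⟨hs, hn⟩ := hw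
  rw [Matrix.sum_mulVec]
  calc ‖∑ i, (w i • B i).mulVec v‖ ≤ ∑ i, ‖(w i • B i).mulVec v‖ := norm_sum_le _ _
    _ ≤ ∑ i, w i * ((⨆ i, opNormInf (B i)) * ‖v‖) := by
        apply Finset.sum_le_sum
        intro i _
        rw [Matrix.smul_mulVec, norm_smul, Real.norm_of_nonneg (hn i)]
        apply mul_le_mul_of_nonneg_left _ (hn i)
        refine (opNormInf_mulVec_le _ _).trans ?_
        exact mul_le_mul_of_nonneg_right
          (le_ciSup (f := fun i => opNormInf (B i)) (Set.finite_range _).bddAbove i)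
          (norm_nonneg _)
    _ = _ := by rw [← Finset.sum_mul, hs, one_mul]

theorem le_gaugeFn {p n : ℕ} (F : Matrix (Fin p) (Fin n) ℝ) (x : Fin n → ℝ) (j : Fin p) :
    F.mulVec x j ≤ gaugeFn F x :=
  le_ciSup (f := fun j => F.mulVec x j) (Set.finite_range _).bddAbove j

/-- Proposition 1(i): under the contraction condition with factor `λ ∈ (0,1)`, worst-case
approximation error `ē` on `S`, `τ = ‖F‖_∞ · maxᵢ ‖Bᵢ‖_∞`, `ρ ∈ (λ,1)` and `b ∈ (0,1]`
with `τē/(ρ−λ) ≤ b` and `τē/(1−λ) < b`, every closed-loop trajectory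
`x(k+1) = A(w_k)x(k) + B(w_k)Φ_NN(x(k))` starting in `S` remains in `S` and satisfies
`Ψ(x(k)) ≤ max(b, ρᵏ Ψ(x(0)))`, i.e., it converges exponentially with rate `ρ` to `bS`. -/
theorem stmt6 {n m p M : ℕ} (hp : 0 < p) (hM : 0 < M)
    (F : Matrix (Fin p) (Fin n) ℝ)
    (hcomp : IsCompact (polySet F))
    (h0 : (0 : Fin n → ℝ) ∈ interior (polySet F))
    (A : Fin M → Matrix (Fin n) (Fin n) ℝ) (B : Fin M → Matrix (Fin n) (Fin m) ℝ)
    (Φ ΦNN : (Fin n → ℝ) → (Fin m → ℝ)) (lam ebar τ ρ b : ℝ)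
    (hlam0 : 0 < lam) (hlam1 : lam < 1)
    (hΦ : ∀ x ∈ polySet F, ∀ w ∈ simplexW M,
      gaugeFn F ((∑ i, w i • A i).mulVec x + (∑ i, w i • B i).mulVec (Φ x))
        ≤ lam * gaugeFn F x)
    (herr : ∀ x ∈ polySet F, ‖Φ x - ΦNN x‖ ≤ ebar)
    (hτ : τ = opNormInf F * ⨆ i, opNormInf (B i))
    (hρ1 : lam < ρ) (hρ2 : ρ < 1)
    (hb0 : 0 < b) (hb1 : b ≤ 1)
    (hbρ : τ * ebar / (ρ - lam) ≤ b)
    (hblam : τ * ebar / (1 - lam) < b)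
    (x : ℕ → (Fin n → ℝ)) (w : ℕ → (Fin M → ℝ))
    (hw : ∀ k, w k ∈ simplexW M)
    (hx0 : x 0 ∈ polySet F)
    (hdyn : ∀ k, x (k + 1) =
      (∑ i, w k i • A i).mulVec (x k) + (∑ i, w k i • B i).mulVec (ΦNN (x k))) :
    ∀ k : ℕ, x k ∈ polySet F ∧ gaugeFn F (x k) ≤ max b (ρ ^ k * gaugeFn F (x 0)) := by
  haveI : Nonempty (Fin p) := ⟨⟨0, hp⟩⟩
  have hS : ∀ y, y ∈ polySet F ↔ gaugeFn F y ≤ 1 := fun y =>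
    ⟨fun h => ciSup_le h, fun h j => (le_gaugeFn F y j).trans h⟩
  have hsup : 0 ≤ ⨆ i, opNormInf (B i) := Real.iSup_nonneg fun i => opNormInf_nonneg _
  have hτe : τ * ebar ≤ (ρ - lam) * b := by
    rw [div_le_iff₀ (by linarith)] at hbρ
    linarith
  have step : ∀ k, x k ∈ polySet F →
      gaugeFn F (x (k + 1)) ≤ lam * gaugeFn F (x k) + τ * ebar := by
    intro k hk
    apply ciSup_le
    intro j
    set e := Φ (x k) - ΦNN (x k) with he
    have h1 : x (k + 1) = ((∑ i, w k i • A i).mulVec (x k) +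
        (∑ i, w k i • B i).mulVec (Φ (x k))) - (∑ i, w k i • B i).mulVec e := by
      rw [hdyn, he, Matrix.mulVec_sub]
      abel
    have h2 := (le_gaugeFn F _ j).trans (hΦ _ hk _ (hw k))
    have h3 : ‖F.mulVec ((∑ i, w k i • B i).mulVec e)‖ ≤ τ * ebar := by
      calc _ ≤ opNormInf F * ‖(∑ i, w k i • B i).mulVec e‖ := opNormInf_mulVec_le _ _
        _ ≤ opNormInf F * ((⨆ i, opNormInf (B i)) * ebar) := by
          apply mul_le_mul_of_nonneg_left _ (opNormInf_nonneg _)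
          exact (simplex_mulVec_le B _ (hw k) e).trans
            (mul_le_mul_of_nonneg_left (herr _ hk) hsup)
        _ = τ * ebar := by rw [hτ]; ring
    have h4 := (norm_le_pi_norm (F.mulVec ((∑ i, w k i • B i).mulVec e)) j).trans h3
    rw [Real.norm_eq_abs] at h4
    have h5 := (abs_le.mp h4).1
    rw [h1, Matrix.mulVec_sub, Pi.sub_apply]
    linarith
  intro k
  induction k with
  | zero => exact ⟨hx0, by simp⟩
  | succ k ih =>
    obtain ⟨hk, hg⟩ := ih
    have hs := step k hk
    have hk1 := (hS _).1 hk
    rw [hS]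
    rcases le_or_gt (gaugeFn F (x k)) b with h | h
    · have : gaugeFn F (x (k + 1)) ≤ b := by nlinarith
      exact ⟨this.trans hb1, this.trans (le_max_left _ _)⟩
    · have h6 : gaugeFn F (x (k + 1)) ≤ ρ * gaugeFn F (x k) := by nlinarith
      refine ⟨by nlinarith, le_max_of_le_right ?_⟩
      have h7 : gaugeFn F (x k) ≤ ρ ^ k * gaugeFn F (x 0) := by
        rcases le_max_iff.1 hg with h' | h'
        · linarith
        · exact h'
      rw [pow_succ]
      nlinarith
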